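/- For every positive integer n and every real number α, the n×n Hankel determinant det(α·c_{i+j} + c_{i+j+1})_{i,j=0}^{n−1} equals g_{2n}(α) · det(c_{i+j})_{i,j=0}^{n−1}. -/

import Mathlib

/-- `dyckGF T n k` is the weighted Dyck path generating function `c(n,k)`:
`c(0,k) = [k = 0]`, `c(n,k) = 0` for `k < 0`, and
`c(n,k) = c(n-1,k-1) + T_k c(n-1,k+1)` for `n ≥ 1`, `k ≥ 0`. -/
def dyckGF (T : ℕ → ℝ) : ℕ → ℤ → ℝ
  | 0, k => if k = 0 then 1 else 0
  | n+1, k =>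
      if k < 0 then 0
      else dyckGF T n (k-1) + T k.toNat * dyckGF T n (k+1)

/-- The polynomials `g_n(α)`: `g_0 = 1`, `g_1 = 1`,
`g_{2n}(α) = α g_{2n-1}(α) + T_{2n-2} g_{2n-2}(α)` and
`g_{2n+1}(α) = g_{2n}(α) + T_{2n-1} g_{2n-1}(α)` for `n ≥ 1`. -/
def gpoly (T : ℕ → ℝ) (α : ℝ) : ℕ → ℝ
  | 0 => 1
  | 1 => 1
  | n+2 => (if (n+2) % 2 = 0 then α else 1) * gpoly T α (n+1) + T n * gpoly T α n

/-- Weighted Motzkin path sums for the level weights `b` and the down-step weights `l`. -/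
def motzkinGF (b l : ℕ → ℝ) : ℕ → ℕ → ℝ
  | 0, k => if k = 0 then 1 else 0
  | m + 1, 0 => b 0 * motzkinGF b l m 0 + l 0 * motzkinGF b l m 1
  | m + 1, k + 1 =>
      motzkinGF b l m k + b (k + 1) * motzkinGF b l m (k + 1) + l (k + 1) * motzkinGF b l m (k + 2)

/-- The entries of the tridiagonal matrix with diagonal `b`, superdiagonal `1`, subdiagonal `l`. -/
def jacobiEntry (b l : ℕ → ℝ) (i j : ℕ) : ℝ :=
  (if i + 1 = j then 1 else 0) + (if i = j then b j else 0) + (if i = j + 1 then l j else 0)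

/-- The leading principal `n × n` submatrix of the tridiagonal matrix given by `jacobiEntry`. -/
def jacobiMatrix (b l : ℕ → ℝ) (n : ℕ) : Matrix (Fin n) (Fin n) ℝ :=
  Matrix.of fun i j => jacobiEntry b l i j

theorem motzkinGF_eq_zero (b l : ℕ → ℝ) {m k : ℕ} (h : m < k) : motzkinGF b l m k = 0 := by
  induction m generalizing k with
  | zero => simp [motzkinGF, h.ne']
  | succ m ih =>
    obtain ⟨k, rfl⟩ : ∃ r, k = r + 1 := ⟨k - 1, by omega⟩
    simp [motzkinGF, ih (show m < k by omega), ih (show m < k + 1 by omega),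
      ih (show m < k + 2 by omega)]

/-- A Christoffel–Darboux type identity. -/
theorem sum_motzkinGF_succ_sub (b l : ℕ → ℝ) (i j N : ℕ) :
    ∑ k ∈ Finset.range (N + 1), (∏ r ∈ Finset.range k, l r) *
        (motzkinGF b l (i + 1) k * motzkinGF b l j k
          - motzkinGF b l i k * motzkinGF b l (j + 1) k)
      = (∏ r ∈ Finset.range (N + 1), l r) *
        (motzkinGF b l i (N + 1) * motzkinGF b l j N
          - motzkinGF b l i N * motzkinGF b l j (N + 1)) := by
  induction N with
  | zero => simp [motzkinGF]; ring
  | succ N ih =>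
    rw [Finset.sum_range_succ, ih, Finset.prod_range_succ _ (N + 1)]
    simp only [motzkinGF]
    ring

theorem sum_motzkinGF_mul_of_add_lt (b l : ℕ → ℝ) {i j N : ℕ} (h : i + j < N) :
    ∑ k ∈ Finset.range N, (∏ r ∈ Finset.range k, l r) *
        (motzkinGF b l i k * motzkinGF b l j k) = motzkinGF b l (i + j) 0 := by
  induction i generalizing j with
  | zero =>
    rw [Finset.sum_eq_single_of_mem 0 (Finset.mem_range.2 (by omega))]
    · simp [motzkinGF]
    · intro k _ hk
      simp [motzkinGF, hk]
  | succ i ih =>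
    obtain ⟨N, rfl⟩ : ∃ r, N = r + 1 := ⟨N - 1, by omega⟩
    have hcd := sum_motzkinGF_succ_sub b l i j N
    rw [motzkinGF_eq_zero b l (show i < N + 1 by omega),
      motzkinGF_eq_zero b l (show j < N + 1 by omega)] at hcd
    simp only [mul_sub, Finset.sum_sub_distrib, zero_mul, mul_zero, sub_zero] at hcd
    rw [sub_eq_zero.1 hcd, ih (by omega)]
    congr 1
    omega

theorem sum_motzkinGF_mul (b l : ℕ → ℝ) (i : ℕ) {j n : ℕ} (h : j < n) :
    ∑ k ∈ Finset.range n, (∏ r ∈ Finset.range k, l r) *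
        (motzkinGF b l i k * motzkinGF b l j k) = motzkinGF b l (i + j) 0 := by
  rw [← sum_motzkinGF_mul_of_add_lt b l (show i + j < n + i + j by omega)]
  refine Finset.sum_subset (Finset.range_mono (by omega)) fun k _ hk => ?_
  rw [motzkinGF_eq_zero b l (show j < k by simp at hk; omega)]
  simp

theorem sum_motzkinGF_mul_jacobiEntry (b l : ℕ → ℝ) {i k n : ℕ} (hi : i < n) (hk : k < n) :
    ∑ r ∈ Finset.range n, motzkinGF b l i r * jacobiEntry b l r k = motzkinGF b l (i + 1) k := by
  have hl : (if k + 1 < n then motzkinGF b l i (k + 1) * l k else 0)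
      = motzkinGF b l i (k + 1) * l k := by
    split_ifs with h
    · rfl
    · rw [motzkinGF_eq_zero b l (show i < k + 1 by omega), zero_mul]
  cases k with
  | zero =>
    rw [zero_add] at hl
    simp only [jacobiEntry, mul_add, Finset.sum_add_distrib, motzkinGF]
    simp [hk]
    rw [hl]
    ring
  | succ k =>
    simp [jacobiEntry, mul_add, Finset.sum_add_distrib, motzkinGF, hk, show k < n by omega]
    rw [hl]
    ring

/-- The Hankel matrix `α μ_{i+j} + μ_{i+j+1}` of the moments `μ_m = motzkinGF b l m 0` has
determinant `det (α + J)` times that of `μ_{i+j}`. -/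
theorem det_hankel_motzkinGF (b l : ℕ → ℝ) (n : ℕ) (α : ℝ) :
    (Matrix.of fun i j : Fin n =>
        α * motzkinGF b l (i + j) 0 + motzkinGF b l (i + j + 1) 0).det
      = (jacobiMatrix (fun k => α + b k) l n).det
        * (Matrix.of fun i j : Fin n => motzkinGF b l (i + j) 0).det := by
  set A : Matrix (Fin n) (Fin n) ℝ := Matrix.of fun i k => motzkinGF b l i k with hA
  set B : Matrix (Fin n) (Fin n) ℝ :=
    Matrix.of fun k j => (∏ r ∈ Finset.range k, l r) * motzkinGF b l j k with hB
  have h₀ : (Matrix.of fun i j : Fin n => motzkinGF b l (i + j) 0) = A * B := by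
    ext i j
    simp only [hA, hB, Matrix.mul_apply, Matrix.of_apply]
    rw [← sum_motzkinGF_mul b l i j.2, Finset.sum_range]
    exact Finset.sum_congr rfl fun k _ => by ring
  have hJ : A * jacobiMatrix (fun k => α + b k) l n
      = Matrix.of fun i k : Fin n => α * motzkinGF b l i k + motzkinGF b l (i + 1) k := by
    ext i k
    have hs : ∀ r : ℕ, jacobiEntry (fun k => α + b k) l r k
        = (if r = k then α else 0) + jacobiEntry b l r k := by
      intro r
      unfold jacobiEntry
      split_ifs <;> ring
    simp only [hA, jacobiMatrix, Matrix.mul_apply, Matrix.of_apply]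
    rw [← sum_motzkinGF_mul_jacobiEntry b l i.2 k.2,
      ← Finset.sum_range fun r => motzkinGF b l i r * jacobiEntry (fun k => α + b k) l r k]
    simp [hs, mul_add, Finset.sum_add_distrib, mul_comm]
  have h₁ : (Matrix.of fun i j : Fin n =>
      α * motzkinGF b l (i + j) 0 + motzkinGF b l (i + j + 1) 0)
        = A * jacobiMatrix (fun k => α + b k) l n * B := by
    rw [hJ]
    ext i j
    simp only [hB, Matrix.mul_apply, Matrix.of_apply]
    rw [← sum_motzkinGF_mul b l i j.2, add_right_comm, ← sum_motzkinGF_mul b l (i + 1) j.2,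
      Finset.mul_sum, ← Finset.sum_add_distrib, Finset.sum_range]
    exact Finset.sum_congr rfl fun k _ => by ring
  rw [h₁, h₀, Matrix.det_mul, Matrix.det_mul, Matrix.det_mul]
  ring

/-- The three-term recurrence for tridiagonal determinants. -/
theorem det_jacobiMatrix_add_two (b l : ℕ → ℝ) (n : ℕ) :
    (jacobiMatrix b l (n + 2)).det
      = b (n + 1) * (jacobiMatrix b l (n + 1)).det - l n * (jacobiMatrix b l n).det := by
  have hmin : ((jacobiMatrix b l (n + 2)).submatrix (Fin.last (n + 1)).succAbove
      (Fin.last n).castSucc.succAbove).det = (jacobiMatrix b l n).det := by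
    rw [Matrix.det_succ_column _ (Fin.last n), Fin.sum_univ_castSucc, Finset.sum_eq_zero]
    · have : ((jacobiMatrix b l (n + 2)).submatrix (Fin.last (n + 1)).succAbove
          (Fin.last n).castSucc.succAbove).submatrix (Fin.last n).succAbove (Fin.last n).succAbove
            = jacobiMatrix b l n := by
        ext i j
        simp [jacobiMatrix, Fin.succAbove, Fin.lt_def]
      rw [this]
      simp [jacobiMatrix, jacobiEntry, Fin.succAbove, ← two_mul, show n ≠ n + 1 + 1 by omega]
    · intro i _
      have := i.2
      simp [jacobiMatrix, jacobiEntry, Fin.succAbove]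
      grind
  have hmaj : (jacobiMatrix b l (n + 2)).submatrix (Fin.last (n + 1)).succAbove
      (Fin.last (n + 1)).succAbove = jacobiMatrix b l (n + 1) := by
    ext i j
    simp [jacobiMatrix]
  rw [Matrix.det_succ_row _ (Fin.last (n + 1)), Fin.sum_univ_castSucc, Fin.sum_univ_castSucc,
    Finset.sum_eq_zero, hmin, hmaj]
  · have h1 : (-1 : ℝ) ^ (n + 1 + n) = -1 := Odd.neg_one_pow ⟨n, by ring⟩
    have h2 : (-1 : ℝ) ^ (n + 1 + (n + 1)) = 1 := Even.neg_one_pow ⟨n + 1, rfl⟩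
    simp [jacobiMatrix, jacobiEntry, h1, h2, show n + 1 + 1 ≠ n by omega]
    ring
  · intro i _
    have := i.2
    simp [jacobiMatrix, jacobiEntry]
    grind

/-- The level weights obtained by grouping the steps of a Dyck path in pairs. -/
def pairedLevelWeight (T : ℕ → ℝ) : ℕ → ℝ
  | 0 => T 0
  | k + 1 => T (2 * k + 1) + T (2 * k + 2)

theorem dyckGF_of_neg (T : ℕ → ℝ) (n : ℕ) {k : ℤ} (hk : k < 0) : dyckGF T n k = 0 := by
  cases n with
  | zero => simp [dyckGF, hk.ne]
  | succ n => simp [dyckGF, hk]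

theorem dyckGF_succ (T : ℕ → ℝ) (n k : ℕ) :
    dyckGF T (n + 1) k = dyckGF T n (k - 1) + T k * dyckGF T n (k + 1) := by
  simp [dyckGF]

theorem dyckGF_two_mul (T : ℕ → ℝ) (m k : ℕ) :
    dyckGF T (2 * m) (2 * k : ℕ)
      = motzkinGF (pairedLevelWeight T) (fun k => T (2 * k) * T (2 * k + 1)) m k := by
  induction m generalizing k with
  | zero => simp [dyckGF, motzkinGF]
  | succ m ih =>
    have hodd : ∀ k : ℕ, dyckGF T (2 * m + 1) (2 * k + 1 : ℕ)
        = dyckGF T (2 * m) (2 * k : ℕ)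
          + T (2 * k + 1) * dyckGF T (2 * m) (2 * (k + 1) : ℕ) := by
      intro k
      rw [dyckGF_succ]
      congr 3 <;> (push_cast; ring)
    rw [show 2 * (m + 1) = 2 * m + 1 + 1 by ring, dyckGF_succ,
      show ((2 * k : ℕ) : ℤ) + 1 = (2 * k + 1 : ℕ) by push_cast; ring, hodd]
    cases k with
    | zero =>
      rw [dyckGF_of_neg T _ (by simp), ih, ih]
      simp [motzkinGF, pairedLevelWeight]
      ring
    | succ k =>
      rw [show ((2 * (k + 1) : ℕ) : ℤ) - 1 = (2 * k + 1 : ℕ) by push_cast; ring, hodd, ih, ih, ih]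
      simp only [motzkinGF, pairedLevelWeight, mul_add, mul_one]
      ring

theorem det_jacobiMatrix_eq_gpoly (T : ℕ → ℝ) (α : ℝ) (n : ℕ) :
    (jacobiMatrix (fun k => α + pairedLevelWeight T k) (fun k => T (2 * k) * T (2 * k + 1)) n).det
      = gpoly T α (2 * n) := by
  induction n using Nat.twoStepInduction with
  | zero => simp [gpoly]
  | one => simp [jacobiMatrix, jacobiEntry, pairedLevelWeight, gpoly]
  | more n ih₀ ih₁ =>
    have h₂ : gpoly T α (2 * (n + 1))
        = α * gpoly T α (2 * n + 1) + T (2 * n) * gpoly T α (2 * n) := by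
      simp [mul_add, gpoly]
    have h₃ : gpoly T α (2 * n + 3)
        = gpoly T α (2 * (n + 1)) + T (2 * n + 1) * gpoly T α (2 * n + 1) := by
      rw [gpoly, if_neg (by omega), one_mul]
      rfl
    have h₄ : gpoly T α (2 * (n + 2))
        = α * gpoly T α (2 * n + 3) + T (2 * n + 2) * gpoly T α (2 * (n + 1)) := by
      rw [show 2 * (n + 2) = 2 * n + 2 + 2 by ring, gpoly, if_pos (by omega)]
      rfl
    rw [det_jacobiMatrix_add_two, ih₀, ih₁, h₄, h₃]
    simp only [pairedLevelWeight]
    linear_combination T (2 * n + 1) * h₂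

/-- Eq. (3.5): for `n ≥ 1` and real `α`,
`det(α c_{i+j} + c_{i+j+1})_{i,j=0}^{n-1} = g_{2n}(α) · det(c_{i+j})_{i,j=0}^{n-1}`. -/
theorem hankel_two_term_dyck_even (T : ℕ → ℝ) (hT : ∀ n, T n ≠ 0)
    (n : ℕ) (hn : 0 < n) (α : ℝ) :
    Matrix.det (Matrix.of fun i j : Fin n =>
        α * dyckGF T (2 * ((i : ℕ) + (j : ℕ))) 0
          + dyckGF T (2 * ((i : ℕ) + (j : ℕ) + 1)) 0)
      = gpoly T α (2 * n)
        * Matrix.det (Matrix.of fun i j : Fin n =>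
            dyckGF T (2 * ((i : ℕ) + (j : ℕ))) 0) := by
  have hc : ∀ m : ℕ, dyckGF T (2 * m) 0
      = motzkinGF (pairedLevelWeight T) (fun k => T (2 * k) * T (2 * k + 1)) m 0 :=
    fun m => dyckGF_two_mul T m 0
  simp only [hc]
  rw [det_hankel_motzkinGF, det_jacobiMatrix_eq_gpoly]
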